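/- arXiv:1305.5335 — 2 statements merged into one kernel-verified Lean document; each statement's English description precedes it below -/
import Mathlib

section
/- Let C be a convex body in ℝⁿ with 0 in its interior, and let f : int C → ℝ_{>0} be a log-concave function with ∫_C f(x)·x dx = 0. Assume that the gradient ∇f(x) exists almost everywhere on int C and that ∫_C ⟨x, ∇f(x)⟩ dx exists. Then ∫_C ⟨x, ∇f(x)⟩ dx ≤ 0. -/
open MeasureTheory
open scoped ENNReal RealInnerProductSpace Classical

/-- A concave function on an open set which is continuous there has a supergradient at each point. -/
theorem ConcaveOn.exists_supergradient {E : Type*} [NormedAddCommGroup E] [NormedSpace ℝ E]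
    {U : Set E} {g : E → ℝ} (hg : ConcaveOn ℝ U g) (hU : IsOpen U) (hgc : ContinuousOn g U)
    {x₀ : E} (hx₀ : x₀ ∈ U) : ∃ a : StrongDual ℝ E, ∀ x ∈ U, g x ≤ g x₀ + a (x - x₀) := by
  have hopen : IsOpen {p : E × ℝ | p.1 ∈ U ∧ p.2 < g p.1} := by
    have hc : ContinuousOn (fun p : E × ℝ => g p.1 - p.2) (U ×ˢ Set.univ) :=
      (hgc.comp continuousOn_fst fun p hp => hp.1).sub continuousOn_snd
    convert! hc.isOpen_inter_preimage (hU.prod isOpen_univ) (isOpen_Ioi (a := (0 : ℝ))) using 1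
    ext p
    simp
  obtain ⟨F, hF⟩ := geometric_hahn_banach_open_point (x := (x₀, g x₀))
    hg.convex_strict_hypograph hopen (by simp)
  have hsplit : ∀ (x : E) (t : ℝ), F (x, t) = F (x, 0) + t * F (0, 1) := fun x t => by
    rw [← smul_eq_mul, ← map_smul, ← map_add]
    simp
  have hc : 0 < F (0, 1) := by
    have h := hF (x₀, g x₀ - 1) ⟨hx₀, by simp⟩
    rw [hsplit, hsplit x₀ (g x₀)] at h
    linarith
  refine ⟨-(F (0, 1))⁻¹ • F.comp (ContinuousLinearMap.inl ℝ E ℝ), fun x hx => ?_⟩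
  have hle : F (x, 0) + g x * F (0, 1) ≤ F (x₀, 0) + g x₀ * F (0, 1) := by
    refine le_of_forall_pos_lt_add fun ε hε => ?_
    have h := hF (x, g x - ε / F (0, 1)) ⟨hx, by simpa using div_pos hε hc⟩
    rw [hsplit, hsplit x₀ (g x₀), sub_mul, div_mul_cancel₀ _ hc.ne'] at h
    linarith
  have hdiff : F (x - x₀, 0) = F (x, 0) - F (x₀, 0) := by
    rw [← map_sub]
    simp
  simp only [smul_apply, ContinuousLinearMap.comp_apply,
    ContinuousLinearMap.inl_apply, smul_eq_mul, hdiff]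
  rw [← mul_le_mul_iff_left₀ hc]
  field_simp
  linarith

/-- The increment of a concave function is at least the increment of its linearization
at the endpoint. -/
theorem ConcaveOn.fderiv_sub_le_sub {E : Type*} [NormedAddCommGroup E] [NormedSpace ℝ E]
    {U : Set E} {g : E → ℝ} (hg : ConcaveOn ℝ U g) {x y : E} (hx : x ∈ U) (hy : y ∈ U)
    {g' : StrongDual ℝ E} (hd : HasFDerivAt g g' y) : g' (y - x) ≤ g y - g x := by
  have hc : ConcaveOn ℝ (AffineMap.lineMap (k := ℝ) x y ⁻¹' U) (g ∘ AffineMap.lineMap x y) :=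
    hg.comp_affineMap _
  have hder : HasDerivAt (g ∘ AffineMap.lineMap (k := ℝ) x y) (g' (y - x)) 1 :=
    HasFDerivAt.comp_hasDerivAt (1 : ℝ) (by simpa using hd) AffineMap.hasDerivAt_lineMap
  have h := hc.le_slope_of_hasDerivAt (x := 0) (y := 1) (by simpa) (by simpa) one_pos hder
  simpa [slope_def_field] using h

/-- The logarithm of a positive log-concave function is concave. -/
theorem concaveOn_log_of_rpow_mul_rpow_le {E : Type*} [AddCommGroup E] [Module ℝ E]
    {U : Set E} (hU : Convex ℝ U) {f : E → ℝ} (hfpos : ∀ x ∈ U, 0 < f x)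
    (hflc : ∀ x ∈ U, ∀ y ∈ U, ∀ l : ℝ, l ∈ Set.Icc (0 : ℝ) 1 →
      f x ^ (1 - l) * f y ^ l ≤ f ((1 - l) • x + l • y)) :
    ConcaveOn ℝ U fun x => Real.log (f x) := by
  refine ⟨hU, fun x hx y hy a b ha hb hab => ?_⟩
  obtain rfl : a = 1 - b := by linarith
  have hfx := hfpos x hx
  have hfy := hfpos y hy
  have h := Real.log_le_log (by positivity) (hflc x hx y hy b ⟨hb, by linarith⟩)
  rwa [Real.log_mul (by positivity) (by positivity), Real.log_rpow hfx, Real.log_rpow hfy] at h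

/-- For a log-concave positive function `f` on the interior of a convex body `C`
with vanishing first moment `∫_C f(x)·x dx = 0`, one has `∫_C ⟨x, ∇f(x)⟩ dx ≤ 0`. -/
theorem logconcave_moment_gradient_nonpos
    (n : ℕ) (C : Set (EuclideanSpace ℝ (Fin n)))
    (hCconv : Convex ℝ C) (hCcpt : IsCompact C)
    (h0 : 0 ∈ interior C)
    (f : EuclideanSpace ℝ (Fin n) → ℝ)
    (hfpos : ∀ x ∈ interior C, 0 < f x)
    (hflc : ∀ x ∈ interior C, ∀ y ∈ interior C, ∀ l : ℝ, l ∈ Set.Icc (0 : ℝ) 1 →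
      f x ^ (1 - l) * f y ^ l ≤ f ((1 - l) • x + l • y))
    (hmom : (∫ x in C, f x • x) = 0)
    (hdiff : ∀ᵐ x ∂(volume.restrict (interior C)), DifferentiableAt ℝ f x)
    (hint : IntegrableOn (fun x => ⟪x, gradient f x⟫) C) :
    (∫ x in C, ⟪x, gradient f x⟫) ≤ 0 := by
  have hrestrict : volume.restrict C = volume.restrict (interior C) :=
    (Measure.restrict_congr_set
      (interior_ae_eq_of_null_frontier (hCconv.addHaar_frontier volume))).symm
  have hg := concaveOn_log_of_rpow_mul_rpow_le hCconv.interior hfpos hflc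
  have hgc := hg.continuousOn isOpen_interior
  obtain ⟨a, ha⟩ := hg.exists_supergradient isOpen_interior hgc h0
  simp only [sub_zero] at ha
  have hfc : ContinuousOn f (interior C) :=
    (Real.continuous_exp.comp_continuousOn hgc).congr fun x hx => (Real.exp_log (hfpos x hx)).symm
  obtain ⟨M, hM⟩ := hCcpt.exists_bound_of_continuousOn
    (f := fun x => Real.exp (Real.log (f 0) + a x) * ‖x‖) (by fun_prop)
  have hfi : IntegrableOn (fun x => f x • x) C := by
    rw [IntegrableOn, hrestrict]
    refine IntegrableOn.of_bound
      ((measure_mono interior_subset).trans_lt hCcpt.measure_lt_top)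
      ((hfc.smul continuousOn_id).aestronglyMeasurable isOpen_interior.measurableSet) M ?_
    refine (ae_restrict_iff' isOpen_interior.measurableSet).2 (.of_forall fun x hx => ?_)
    refine le_trans ?_ ((le_abs_self _).trans (hM x (interior_subset hx)))
    rw [norm_smul, Real.norm_of_nonneg (hfpos x hx).le]
    gcongr
    exact (Real.log_le_iff_le_exp (hfpos x hx)).1 (ha x hx)
  have hai : (∫ x in C, a (f x • x)) = 0 := by
    rw [a.integral_comp_comm hfi, hmom, map_zero]
  rw [← hai]
  refine integral_mono_ae hint (a.integrable_comp hfi) ?_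
  rw [hrestrict]
  filter_upwards [hdiff, ae_restrict_mem isOpen_interior.measurableSet] with x hdx hx
  have hfx := hfpos x hx
  have h := hg.fderiv_sub_le_sub h0 hx (hdx.hasFDerivAt.log hfx.ne')
  have hx' := ha x hx
  simp only [sub_zero, smul_apply, smul_eq_mul] at h
  have h' : (f x)⁻¹ * fderiv ℝ f x x ≤ a x := by linarith
  rw [inv_mul_le_iff₀ hfx] at h'
  simpa [real_inner_comm, inner_gradient_right] using h'
end

section
/- Let P be an n-dimensional convex polytope in ℝⁿ with 0 in its interior and set of outer unit normals A. If there exist complementary linear subspaces L and L̄ of ℝⁿ with A = (A ∩ L) ∪ (A ∩ L̄), then P = (P ∩ L^⊥) + (P ∩ L̄^⊥), a Minkowski sum decomposition. -/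
open MeasureTheory
open scoped ENNReal RealInnerProductSpace Classical Pointwise

/-- Orthogonal complements of disjoint subspaces of a finite-dimensional space span it. -/
theorem orthogonal_sup_orthogonal_eq_top_of_disjoint {E : Type*} [NormedAddCommGroup E]
    [InnerProductSpace ℝ E] [FiniteDimensional ℝ E] {K K' : Submodule ℝ E}
    (h : Disjoint K K') : Kᗮ ⊔ K'ᗮ = ⊤ := by
  rw [← Submodule.orthogonal_eq_bot_iff, ← Submodule.inf_orthogonal,
    Submodule.orthogonal_orthogonal, Submodule.orthogonal_orthogonal]
  exact h.eq_bot

/-- If the set `A` of outer unit normals of a polytope `P` splits into complementary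
subspaces `L` and `L̄`, then `P` decomposes as the Minkowski sum
`P = (P ∩ L^⊥) + (P ∩ L̄^⊥)`. -/
theorem normal_split_implies_minkowski_decomposition
    (n m : ℕ)
    (P : Set (EuclideanSpace ℝ (Fin n)))
    (a : Fin m → EuclideanSpace ℝ (Fin n)) (b : Fin m → ℝ)
    (F : Fin m → Set (EuclideanSpace ℝ (Fin n)))
    (hP : P = {x | ∀ i, ⟪a i, x⟫ ≤ b i})
    (hPcpt : IsCompact P)
    (h0 : 0 ∈ interior P)
    (ha : ∀ i, ‖a i‖ = 1)
    (hainj : Function.Injective a)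
    (hb : ∀ i, 0 < b i)
    (hF : ∀ i, F i = P ∩ {x | ⟪a i, x⟫ = b i})
    (hfacet : ∀ i, 0 < μH[(n : ℝ) - 1] (F i))
    (L L' : Submodule ℝ (EuclideanSpace ℝ (Fin n)))
    (hcompl : IsCompl L L')
    (hsplit : Set.range a =
      (Set.range a ∩ (L : Set (EuclideanSpace ℝ (Fin n))))
        ∪ (Set.range a ∩ (L' : Set (EuclideanSpace ℝ (Fin n))))) :
    P = (P ∩ (Lᗮ : Set (EuclideanSpace ℝ (Fin n))))
          + (P ∩ (L'ᗮ : Set (EuclideanSpace ℝ (Fin n)))) := by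
  have h_split : ∀ i, a i ∈ L ∨ a i ∈ L' := fun i => by
    have hi : a i ∈ Set.range a := ⟨i, rfl⟩
    rw [hsplit] at hi
    exact hi.imp And.right And.right
  subst hP
  ext x
  constructor
  · intro hx
    have hx_top : x ∈ Lᗮ ⊔ L'ᗮ := by
      rw [orthogonal_sup_orthogonal_eq_top_of_disjoint hcompl.disjoint]
      exact Submodule.mem_top
    obtain ⟨u, hu, v, hv, rfl⟩ := Submodule.mem_sup.mp hx_top
    refine Set.add_mem_add ⟨fun i => ?_, hu⟩ ⟨fun i => ?_, hv⟩ <;>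
    · have hxi := hx i
      rw [inner_add_right] at hxi
      rcases h_split i with h | h
      · have := Submodule.inner_right_of_mem_orthogonal h hu
        linarith [hb i]
      · have := Submodule.inner_right_of_mem_orthogonal h hv
        linarith [hb i]
  · rintro ⟨u, ⟨hu, huL⟩, v, ⟨hv, hvL⟩, rfl⟩ i
    have hui := hu i
    have hvi := hv i
    simp only [inner_add_right]
    rcases h_split i with h | h
    · have := Submodule.inner_right_of_mem_orthogonal h huL
      linarith
    · have := Submodule.inner_right_of_mem_orthogonal h hvL
      linarith
end
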